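/- Let X be an n×p real matrix and s an integer with 1 ≤ 2s ≤ p. For all disjoint sets T, T' ⊆ {1,…,p} with |T| + |T'| ≤ 2s and all vectors u, u' ∈ ℝ^p supported on T and T' respectively, |⟨Xu, Xu'⟩|/n ≤ ((Λ_max(2s) − Λ_min(2s))/2)·‖u‖₂·‖u'‖₂. Consequently θ_{m,m'} ≤ (Λ_max(2s) − Λ_min(2s))/2 for all m, m' ≥ 1 with m + m' ≤ 2s. -/

import Mathlib

open Finset Matrix Real
open scoped BigOperators Classical

noncomputable section

namespace ThreshLasso

/-- ℓ₂ norm of a finite real vector. -/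
def l2 {m : ℕ} (v : Fin m → ℝ) : ℝ := Real.sqrt (∑ i, (v i) ^ 2)

/-- ℓ₁ norm of a finite real vector. -/
def l1 {m : ℕ} (v : Fin m → ℝ) : ℝ := ∑ i, |v i|

/-- Restriction of a vector to a set of coordinates (zero outside). -/
def restr {p : ℕ} (v : Fin p → ℝ) (T : Finset (Fin p)) : Fin p → ℝ :=
  fun j => if j ∈ T then v j else 0

/-- Support of a vector, as a `Finset`. -/
def supp {p : ℕ} (v : Fin p → ℝ) : Finset (Fin p) :=
  Finset.univ.filter fun j => v j ≠ 0

/-- `L` is the minimal `m`-sparse eigenvalue `Λ_min(m)` of `X`: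
the least value of `‖Xv‖₂²/(n‖v‖₂²)` over nonzero `v` with at most `m`
nonzero coordinates. -/
def IsLambdaMin {n p : ℕ} (X : Matrix (Fin n) (Fin p) ℝ) (m : ℕ) (L : ℝ) : Prop :=
  IsLeast {r : ℝ | ∃ v : Fin p → ℝ, v ≠ 0 ∧ (supp v).card ≤ m ∧
    r = (l2 (X.mulVec v)) ^ 2 / (n * (l2 v) ^ 2)} L

/-- `L` is the maximal `m`-sparse eigenvalue `Λ_max(m)` of `X`
(with the convention `Λ_max(0) = 0`, implemented by inserting `0` in the set,
which does not change the maximum when `m ≥ 1`). -/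
def IsLambdaMax {n p : ℕ} (X : Matrix (Fin n) (Fin p) ℝ) (m : ℕ) (L : ℝ) : Prop :=
  IsGreatest (insert (0 : ℝ) {r : ℝ | ∃ v : Fin p → ℝ, v ≠ 0 ∧ (supp v).card ≤ m ∧
    r = (l2 (X.mulVec v)) ^ 2 / (n * (l2 v) ^ 2)}) L

/-- `θ` is the restricted orthogonality constant `θ_{m,m'}` of `X`: the smallest
nonnegative `t` such that `|⟨Xu, Xu'⟩|/n ≤ t‖u‖₂‖u'‖₂` for all `u, u'` supported
on disjoint sets of cardinality at most `m`, `m'` respectively. -/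
def IsTheta {n p : ℕ} (X : Matrix (Fin n) (Fin p) ℝ) (m m' : ℕ) (θ : ℝ) : Prop :=
  IsLeast {t : ℝ | 0 ≤ t ∧ ∀ (u u' : Fin p → ℝ) (T T' : Finset (Fin p)),
    Disjoint T T' → T.card ≤ m → T'.card ≤ m' →
    (∀ j, j ∉ T → u j = 0) → (∀ j, j ∉ T' → u' j = 0) →
    |∑ i, (X.mulVec u i) * (X.mulVec u' i)| / n ≤ t * (l2 u * l2 u')} θ

/-- Restricted eigenvalue condition `RE(s₀, k₀, X)` with constant `K`. -/
def RECond {n p : ℕ} (X : Matrix (Fin n) (Fin p) ℝ) (s₀ : ℕ) (k₀ K : ℝ) : Prop :=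
  0 < K ∧ ∀ (v : Fin p → ℝ) (J : Finset (Fin p)), J.card ≤ s₀ →
    l1 (restr v Jᶜ) ≤ k₀ * l1 (restr v J) →
    l2 (restr v J) / K ≤ l2 (X.mulVec v) / Real.sqrt n

/-- `s₀` is the essential sparsity of `β`: the smallest nonnegative integer `m`
with `∑ᵢ min(βᵢ², λ²σ²) ≤ m λ²σ²`. -/
def EssSparsity {p : ℕ} (β : Fin p → ℝ) (lam σ : ℝ) (s₀ : ℕ) : Prop :=
  IsLeast {m : ℕ | ∑ i, min ((β i) ^ 2) (lam ^ 2 * σ ^ 2) ≤ (m : ℝ) * (lam ^ 2 * σ ^ 2)} s₀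

/-- `T₀` is a set of indices of the `s₀` largest coordinates of `β` in absolute value. -/
def TopSet {p : ℕ} (β : Fin p → ℝ) (s₀ : ℕ) (T₀ : Finset (Fin p)) : Prop :=
  T₀.card = s₀ ∧ ∀ i ∈ T₀, ∀ j, j ∉ T₀ → |β j| ≤ |β i|

/-- `T₁` is a set of indices of the `s₀` largest coordinates of `h` in absolute
value outside `T₀`. -/
def TopSetOutside {p : ℕ} (h : Fin p → ℝ) (s₀ : ℕ) (T₀ T₁ : Finset (Fin p)) : Prop :=
  T₁.card = s₀ ∧ Disjoint T₀ T₁ ∧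
    ∀ i ∈ T₁, ∀ j, j ∉ T₀ → j ∉ T₁ → |h j| ≤ |h i|

/-- `b` is a Lasso minimizer with penalty `lamn` for data `(X, Y)`. -/
def IsLassoSol {n p : ℕ} (X : Matrix (Fin n) (Fin p) ℝ) (Y : Fin n → ℝ)
    (lamn : ℝ) (b : Fin p → ℝ) : Prop :=
  ∀ b' : Fin p → ℝ,
    1 / (2 * n) * (l2 (Y - X.mulVec b)) ^ 2 + lamn * l1 b ≤
    1 / (2 * n) * (l2 (Y - X.mulVec b')) ^ 2 + lamn * l1 b'

/-- Submatrix of the columns of `X` indexed by `I`. -/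
def colSub {n p : ℕ} (X : Matrix (Fin n) (Fin p) ℝ) (I : Finset (Fin p)) :
    Matrix (Fin n) {j // j ∈ I} ℝ :=
  Matrix.of fun i j => X i j.1

/-- The Gram matrix `X_Iᵀ X_I` is invertible. -/
def GramInvertible {n p : ℕ} (X : Matrix (Fin n) (Fin p) ℝ) (I : Finset (Fin p)) : Prop :=
  IsUnit ((colSub X I)ᵀ * colSub X I).det

/-- The OLS refit of `Y` on the columns of `X` indexed by `I`:
`(X_Iᵀ X_I)⁻¹ X_Iᵀ Y` on `I`, and `0` off `I`. -/
def olsRefit {n p : ℕ} (X : Matrix (Fin n) (Fin p) ℝ) (Y : Fin n → ℝ)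
    (I : Finset (Fin p)) : Fin p → ℝ :=
  fun j => if h : j ∈ I then
    (((colSub X I)ᵀ * colSub X I)⁻¹).mulVec ((colSub X I)ᵀ.mulVec Y) ⟨j, h⟩
  else 0


theorem l2_sq {m : ℕ} (v : Fin m → ℝ) : (l2 v) ^ 2 = ∑ i, (v i) ^ 2 :=
  Real.sq_sqrt (Finset.sum_nonneg fun _ _ => sq_nonneg _)

theorem l2_nonneg {m : ℕ} (v : Fin m → ℝ) : 0 ≤ l2 v := Real.sqrt_nonneg _

theorem l2_eq_zero {m : ℕ} {v : Fin m → ℝ} (h : l2 v = 0) : v = 0 := by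
  have h2 := l2_sq v
  rw [h, zero_pow two_ne_zero, eq_comm,
    Finset.sum_eq_zero_iff_of_nonneg fun _ _ => sq_nonneg _] at h2
  funext i
  exact pow_eq_zero_iff two_ne_zero |>.mp (h2 i (Finset.mem_univ i))

theorem l2_linear_comb_sq {m : ℕ} (a b : ℝ) (v w : Fin m → ℝ) :
    (l2 (a • v + b • w)) ^ 2 =
      a ^ 2 * (l2 v) ^ 2 + 2 * a * b * (∑ i, v i * w i) + b ^ 2 * (l2 w) ^ 2 := by
  simp only [l2_sq, Finset.mul_sum, ← Finset.sum_add_distrib, Pi.add_apply, Pi.smul_apply,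
    smul_eq_mul]
  exact Finset.sum_congr rfl fun i _ => by ring

theorem IsLambdaMin.mul_le {n p m : ℕ} {X : Matrix (Fin n) (Fin p) ℝ} {L : ℝ} (hn : 0 < n)
    (h : IsLambdaMin X m L) {v : Fin p → ℝ} (hv : (supp v).card ≤ m) :
    L * (n * (l2 v) ^ 2) ≤ (l2 (X.mulVec v)) ^ 2 := by
  by_cases h0 : l2 v = 0
  · simpa [h0] using sq_nonneg (l2 (X.mulVec v))
  · have hpos : 0 < (n : ℝ) * (l2 v) ^ 2 := by positivity
    refine (le_div_iff₀ hpos).mp (h.2 ⟨v, ?_, hv, rfl⟩)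
    rintro rfl
    exact h0 (by simp [l2])

theorem IsLambdaMax.le_mul {n p m : ℕ} {X : Matrix (Fin n) (Fin p) ℝ} {L : ℝ} (hn : 0 < n)
    (h : IsLambdaMax X m L) {v : Fin p → ℝ} (hv : (supp v).card ≤ m) :
    (l2 (X.mulVec v)) ^ 2 ≤ L * (n * (l2 v) ^ 2) := by
  by_cases h0 : l2 v = 0
  · simp [l2_eq_zero h0, l2]
  · have hpos : 0 < (n : ℝ) * (l2 v) ^ 2 := by positivity
    refine (div_le_iff₀ hpos).mp (h.2 (Or.inr ⟨v, ?_, hv, rfl⟩))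
    rintro rfl
    exact h0 (by simp [l2])

theorem card_supp_linear_comb_le {p : ℕ} {T T' : Finset (Fin p)} {u u' : Fin p → ℝ}
    (hu : ∀ j, j ∉ T → u j = 0) (hu' : ∀ j, j ∉ T' → u' j = 0) (a b : ℝ) :
    (supp (a • u + b • u')).card ≤ T.card + T'.card := by
  refine (Finset.card_le_card fun j hj => ?_).trans (Finset.card_union_le T T')
  by_contra hj'
  rw [Finset.mem_union, not_or] at hj'
  simp [supp, hu j hj'.1, hu' j hj'.2] at hj

theorem sum_mul_eq_zero_of_disjoint {p : ℕ} {T T' : Finset (Fin p)} {u u' : Fin p → ℝ}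
    (hd : Disjoint T T') (hu : ∀ j, j ∉ T → u j = 0) (hu' : ∀ j, j ∉ T' → u' j = 0) :
    ∑ j, u j * u' j = 0 :=
  Finset.sum_eq_zero fun j _ => by
    by_cases hj : j ∈ T
    · rw [hu' j (Finset.disjoint_left.mp hd hj), mul_zero]
    · rw [hu j hj, zero_mul]

theorem abs_inner_mulVec_le {n p m : ℕ} (hn : 0 < n) {X : Matrix (Fin n) (Fin p) ℝ}
    {Lmin Lmax : ℝ} (hmin : IsLambdaMin X m Lmin) (hmax : IsLambdaMax X m Lmax)
    {T T' : Finset (Fin p)} {u u' : Fin p → ℝ} (hd : Disjoint T T')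
    (hc : T.card + T'.card ≤ m)
    (hu : ∀ j, j ∉ T → u j = 0) (hu' : ∀ j, j ∉ T' → u' j = 0) :
    |∑ i, (X.mulVec u i) * (X.mulVec u' i)| / n ≤ ((Lmax - Lmin) / 2) * (l2 u * l2 u') := by
  by_cases h0 : l2 u = 0
  · simp [l2_eq_zero h0, l2]
  by_cases h0' : l2 u' = 0
  · simp [l2_eq_zero h0', l2]
  have ha : 0 < l2 u := (l2_nonneg u).lt_of_ne' h0
  have hb : 0 < l2 u' := (l2_nonneg u').lt_of_ne' h0'
  have hsupp (c d : ℝ) := (card_supp_linear_comb_le hu hu' c d).trans hc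
  have lower₁ := hmin.mul_le hn (hsupp (l2 u') (l2 u))
  have lower₂ := hmin.mul_le hn (hsupp (l2 u') (-l2 u))
  have upper₁ := hmax.le_mul hn (hsupp (l2 u') (l2 u))
  have upper₂ := hmax.le_mul hn (hsupp (l2 u') (-l2 u))
  simp only [Matrix.mulVec_add, Matrix.mulVec_smul, l2_linear_comb_sq,
    sum_mul_eq_zero_of_disjoint hd hu hu'] at lower₁ lower₂ upper₁ upper₂
  have hab : 0 < 4 * (l2 u * l2 u') := by positivity
  rw [div_le_iff₀ (by exact_mod_cast hn), abs_le]
  constructor <;> refine le_of_mul_le_mul_left ?_ hab <;> linarith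

theorem IsLambdaMin.le_isLambdaMax {n p m : ℕ} {X : Matrix (Fin n) (Fin p) ℝ} {Lmin Lmax : ℝ}
    (hmin : IsLambdaMin X m Lmin) (hmax : IsLambdaMax X m Lmax) : Lmin ≤ Lmax :=
  hmax.2 (Or.inr hmin.1)

/-- Parallelogram-identity bound on restricted orthogonality. -/
theorem statement_3
    (n p s : ℕ) (hn : 0 < n) (hs : 1 ≤ s) (h2s : 2 * s ≤ p)
    (X : Matrix (Fin n) (Fin p) ℝ)
    (Lmin2s Lmax2s : ℝ)
    (hLmin2s : IsLambdaMin X (2 * s) Lmin2s)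
    (hLmax2s : IsLambdaMax X (2 * s) Lmax2s) :
    (∀ (T T' : Finset (Fin p)) (u u' : Fin p → ℝ),
      Disjoint T T' → T.card + T'.card ≤ 2 * s →
      (∀ j, j ∉ T → u j = 0) → (∀ j, j ∉ T' → u' j = 0) →
      |∑ i, (X.mulVec u i) * (X.mulVec u' i)| / n ≤
        ((Lmax2s - Lmin2s) / 2) * (l2 u * l2 u')) ∧
    ∀ (m m' : ℕ) (θ : ℝ), 1 ≤ m → 1 ≤ m' → m + m' ≤ 2 * s →
      IsTheta X m m' θ → θ ≤ (Lmax2s - Lmin2s) / 2 := by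
  refine ⟨fun T T' u u' hd hc hu hu' => abs_inner_mulVec_le hn hLmin2s hLmax2s hd hc hu hu',
    fun m m' θ _ _ hmm hθ => hθ.2 ⟨?_, fun u u' T T' hd hT hT' hu hu' => ?_⟩⟩
  · linarith [hLmin2s.le_isLambdaMax hLmax2s]
  · exact abs_inner_mulVec_le hn hLmin2s hLmax2s hd (by omega) hu hu'

end ThreshLasso
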